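/- Let m be a positive integer with m not congruent to 0 modulo 3, let n = 5m, and let d = 2^(2m+1) - 2^m - 1. Then the power function F(x) = x^d over F_{2^n} is 0-APN; that is, (x+1)^d + x^d + 1 = 0 has no solution x in F_{2^n} \ {0,1}. -/

import Mathlib

namespace ZApn

def rot (k : ℕ) : ℕ :=
  k / 12 % 12 + 12 * (k / 12 / 12 % 12 + 12 * (k / 12 / 12 / 12 % 12 +
    12 * (k / 12 / 12 / 12 / 12 % 12 + 12 * (k % 12))))
def rotL (l : List ℕ) : List ℕ := l.map rot
def orb (l : List ℕ) : List ℕ :=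
  l ++ (rotL l ++ (rotL (rotL l) ++ (rotL (rotL (rotL l)) ++ rotL (rotL (rotL (rotL l))))))

def toN (l : List ℕ) : ℕ := l.foldr (fun m r => Nat.xor (Nat.shiftLeft 1 m) r) 0
def mulN (p : List ℕ) (q : ℕ) : ℕ := p.foldr (fun m r => Nat.xor (Nat.shiftLeft q m) r) 0

def ok (B k : ℕ) : Bool :=
  Nat.ble k 248831 && Nat.ble (k / 12 / 12 / 12 / 12 % 12) B && Nat.ble (k / 12 / 12 / 12 % 12) B &&
    Nat.ble (k / 12 / 12 % 12) B && Nat.ble (k / 12 % 12) B && Nat.ble (k % 12) B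

def tot (L : List (List ℕ × List ℕ)) : ℕ :=
  L.foldr (fun x r => Nat.xor (mulN x.1 (toN x.2)) r) 0

def check (L : List (List ℕ × List ℕ)) : Bool :=
  L.all (fun x => x.1.all (ok 7) && x.2.all (ok 4)) && Nat.beq (tot L) 0

section sem
set_option linter.unusedSectionVars false
variable {K : Type*} [Field K] [CharP K 2]

def val (a b c d e : K) (k : ℕ) : K :=
  a ^ (k / 12 / 12 / 12 / 12 % 12) * b ^ (k / 12 / 12 / 12 % 12) * c ^ (k / 12 / 12 % 12) * d ^ (k / 12 % 12) * e ^ (k % 12)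

def ev (a b c d e : K) (l : List ℕ) : K := (l.map (val a b c d e)).sum

theorem val_rot (a b c d e : K) (k : ℕ) : val a b c d e (rot k) = val b c d e a k := by
  have h1 : ∀ x y : ℕ, (x % 12 + 12 * y) % 12 = x % 12 := by intro x y; omega
  have h2 : ∀ x y : ℕ, (x % 12 + 12 * y) / 12 = y := by intro x y; omega
  unfold val rot
  simp only [h1, h2, Nat.mod_mod]
  ring

theorem ev_rot (a b c d e : K) (l : List ℕ) : ev a b c d e (rotL l) = ev b c d e a l := by
  unfold ev rotL
  rw [List.map_map]
  congr 1
  apply List.map_congr_left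
  intro k _
  exact val_rot a b c d e k

theorem ev_append (a b c d e : K) (l l' : List ℕ) :
    ev a b c d e (l ++ l') = ev a b c d e l + ev a b c d e l' := by
  simp [ev]

theorem ev_orb (a b c d e : K) (l : List ℕ) :
    ev a b c d e (orb l) = ev a b c d e l + (ev b c d e a l + (ev c d e a b l +
      (ev d e a b c l + ev e a b c d l))) := by
  simp only [orb, ev_append, ev_rot]

theorem val_add (a b c d e : K) (m k : ℕ) (hm : ok 7 m = true) (hk : ok 4 k = true) :
    val a b c d e (m + k) = val a b c d e m * val a b c d e k := by
  simp only [ok, Bool.and_eq_true, Nat.ble_eq] at hm hk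
  obtain ⟨⟨⟨⟨⟨-, a1⟩, a2⟩, a3⟩, a4⟩, a5⟩ := hm
  obtain ⟨⟨⟨⟨⟨-, b1⟩, b2⟩, b3⟩, b4⟩, b5⟩ := hk
  have h1 : ∀ x y : ℕ, x % 12 ≤ 7 → y % 12 ≤ 4 → (x + y) % 12 = x % 12 + y % 12 := by
    intro x y _ _; omega
  have h2 : ∀ x y : ℕ, x % 12 ≤ 7 → y % 12 ≤ 4 → (x + y) / 12 = x / 12 + y / 12 := by
    intro x y _ _; omega
  unfold val
  rw [h2 m k a5 b5, h2 _ _ a4 b4, h2 _ _ a3 b3, h2 _ _ a2 b2, h1 _ _ a5 b5, h1 _ _ a4 b4,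
    h1 _ _ a3 b3, h1 _ _ a2 b2, h1 _ _ a1 b1]
  ring

def S (v : ℕ → K) (n : ℕ) : K :=
  ∑ k ∈ Finset.range 600000, if n.testBit k then v k else 0

theorem S_zero (v : ℕ → K) : S v 0 = 0 := by simp [S]

theorem S_xor (v : ℕ → K) (x y : ℕ) : S v (Nat.xor x y) = S v x + S v y := by
  unfold S
  rw [← Finset.sum_add_distrib]
  apply Finset.sum_congr rfl
  intro k _
  have : (Nat.xor x y).testBit k = ((x.testBit k) ^^ (y.testBit k)) := Nat.testBit_xor x y k
  rw [this]
  cases x.testBit k <;> cases y.testBit k <;> simp [CharTwo.add_self_eq_zero]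

theorem S_one (v : ℕ → K) (m : ℕ) (hm : m < 600000) : S v (Nat.shiftLeft 1 m) = v m := by
  have : Nat.shiftLeft 1 m = 2 ^ m := by
    have := Nat.shiftLeft_eq 1 m
    rw [one_mul] at this; exact this
  rw [this]
  unfold S
  simp only [Nat.testBit_two_pow]
  simp [hm]

theorem shl_xor (x y m : ℕ) :
    Nat.shiftLeft (Nat.xor x y) m = Nat.xor (Nat.shiftLeft x m) (Nat.shiftLeft y m) :=
  Nat.shiftLeft_xor_distrib

theorem S_shift (a b c d e : K) (m : ℕ) (hm : ok 7 m = true) (q : List ℕ)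
    (hq : ∀ k ∈ q, ok 4 k = true) :
    S (val a b c d e) (Nat.shiftLeft (toN q) m) = val a b c d e m * ev a b c d e q := by
  induction q with
  | nil =>
    have : Nat.shiftLeft (toN []) m = 0 := Nat.zero_shiftLeft m
    rw [this, S_zero]; simp [ev]
  | cons k q ih =>
    have h1 : toN (k :: q) = Nat.xor (Nat.shiftLeft 1 k) (toN q) := rfl
    have h2 : ev a b c d e (k :: q) = val a b c d e k + ev a b c d e q := by simp [ev]
    have h3 : Nat.shiftLeft (Nat.shiftLeft 1 k) m = Nat.shiftLeft 1 (m + k) := by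
      rw [Nat.add_comm]; exact (Nat.shiftLeft_add 1 k m).symm
    have hk := hq k (by simp)
    have hlt : m + k < 600000 := by
      simp only [ok, Bool.and_eq_true, Nat.ble_eq] at hm hk
      omega
    rw [h1, shl_xor, S_xor, ih (fun j hj => hq j (by simp [hj])), h2, h3, S_one _ _ hlt,
      val_add a b c d e m k hm hk]
    ring

theorem S_mul (a b c d e : K) (p q : List ℕ) (hp : ∀ k ∈ p, ok 7 k = true)
    (hq : ∀ k ∈ q, ok 4 k = true) :
    S (val a b c d e) (mulN p (toN q)) = ev a b c d e p * ev a b c d e q := by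
  induction p with
  | nil =>
    have : mulN [] (toN q) = 0 := rfl
    rw [this, S_zero]; simp [ev]
  | cons k p ih =>
    have h1 : mulN (k :: p) (toN q) = Nat.xor (Nat.shiftLeft (toN q) k) (mulN p (toN q)) := rfl
    have h2 : ev a b c d e (k :: p) = val a b c d e k + ev a b c d e p := by simp [ev]
    rw [h1, S_xor, ih (fun j hj => hp j (by simp [hj])), h2,
      S_shift a b c d e k (hp k (by simp)) q hq]
    ring

theorem S_tot (a b c d e : K) (L : List (List ℕ × List ℕ))
    (hL : L.all (fun x => x.1.all (ok 7) && x.2.all (ok 4)) = true) :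
    S (val a b c d e) (tot L) = (L.map (fun x => ev a b c d e x.1 * ev a b c d e x.2)).sum := by
  induction L with
  | nil =>
    have : tot [] = 0 := rfl
    rw [this, S_zero]; simp
  | cons x L ih =>
    have h1 : tot (x :: L) = Nat.xor (mulN x.1 (toN x.2)) (tot L) := rfl
    rw [List.all_cons, Bool.and_eq_true, Bool.and_eq_true, List.all_eq_true, List.all_eq_true] at hL
    rw [h1, S_xor, ih hL.2, S_mul a b c d e _ _ hL.1.1 hL.1.2]
    simp

theorem sound (L : List (List ℕ × List ℕ)) (h : check L = true) (a b c d e : K) :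
    (L.map (fun x => ev a b c d e x.1 * ev a b c d e x.2)).sum = 0 := by
  unfold check at h
  rw [Bool.and_eq_true] at h
  rw [← S_tot a b c d e L h.1, Nat.eq_of_beq_eq_true h.2, S_zero]

end sem

def pE : List ℕ :=
  [288, 2016, 21024, 24192, 43200, 44928]

def pF : List ℕ :=
  [576, 2304, 21312, 24480, 41496, 41640, 43224, 45072]

def pQ : List ℕ :=
  [5, 17, 38, 60, 147, 149, 158, 204, 313, 434, 576, 588, 1742, 1764,
  1788, 1920, 2017, 2160, 2304, 3469, 3481, 3601, 3602, 3624, 3636, 3746, 3768, 5185,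
  5209, 5330, 5352, 20736, 20737, 20739, 20740, 20748, 20752, 20784, 20880, 20881, 20882, 20884,
  20892, 20928, 22464, 22465, 22466, 22476, 22478, 22489, 22500, 22512, 22752, 24193, 24206, 24217,
  24228, 24336, 24480, 25921, 25922, 62208, 62209, 62220]

def pA : List ℕ := orb
  [20880, 22464, 22476, 22620, 41616, 41617, 41629, 41760, 43213, 43345, 43488, 44928, 62209, 62232,
  62364, 63936, 63948, 64080, 83088, 103680]

def pB : List ℕ := orb
  [0, 22608, 22620, 41473, 41484, 41760, 43201, 43213, 43224, 43344, 43488, 44929, 62220, 62221,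
  62232, 62496, 63937, 63948, 82944, 82956, 84672]

def pC : List ℕ := orb
  [20736, 20880, 41617, 43212, 43224, 43345, 43356, 43488, 44928, 62209, 62220, 62352, 62353, 62364,
  63936, 63937, 63948, 82944, 82956, 83088]

def pH : List ℕ := orb
  [22464, 22608, 41616, 41617, 41628, 41629, 41761, 43212, 43345, 43356, 62220, 62221, 62496, 63936,
  63937, 63948]

def pU : List ℕ := orb
  [22464, 22476, 22608, 22620, 41472, 41616, 41617, 41628, 41629, 41761, 43200, 43213, 43344, 62208,
  62352, 62353, 62364, 62496, 63937, 63948, 84672, 124416]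

def LF : List (List ℕ × List ℕ) :=
  [(pF, [0]), ([288], pE), ([41472], rotL pE)]

def kQ0 : List ℕ :=
  [24, 26, 36, 180, 1729, 1753, 1874, 1884, 1896, 2028, 20760, 20761, 20772, 20882,
  21024, 21036, 22465, 22466, 22608, 22752]

def kQ1 : List ℕ :=
  [1, 146, 156, 300, 20737, 20738, 20772, 20892, 20904, 21024, 22476, 41473, 41496, 41628,
  43200, 43212, 63936]

def kQ2 : List ℕ :=
  [12, 1740, 1884, 3456, 3458, 3600, 20738, 20748, 20760, 20892, 24204, 24336, 41484, 41496,
  43200, 43212, 43344, 44928, 63936]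

def kQ3 : List ℕ :=
  [0, 144, 1728, 2016, 3600, 3744, 20736, 20880, 22464, 41472, 62208]

def kQ4 : List ℕ :=
  [2, 3, 14, 15, 145, 146, 147, 168, 20738, 20749, 20750, 20760, 20881, 20882]

def kQ6 : List ℕ :=
  [41484, 41616, 62208]

def LQ : List (List ℕ × List ℕ) :=
  [(pQ, [20736, 41472]),
   (kQ0, pE),
   (kQ1, rotL (pE)),
   (kQ2, rotL (rotL (pE))),
   (kQ3, rotL (rotL (rotL (pE)))),
   (kQ4, rotL (rotL (rotL (rotL (pE))))),
   (kQ6, rotL (pF))]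

def kA0 : List ℕ :=
  [0, 2, 4, 5, 13, 14, 24, 37, 48, 49, 60, 156, 157, 159,
  169, 180, 192, 288, 289, 290, 301, 324, 433, 444, 456, 588, 1732, 1753,
  1776, 1874, 1875, 1884, 1885, 2016, 2029, 2160, 2304, 3456, 3459, 3469, 3480, 3600,
  3601, 3602, 3612, 3613, 3624, 3745, 5186, 5197, 5328, 8640, 20737, 20739, 20749, 20750,
  20751, 20761, 20881, 20883, 20892, 20904, 20905, 20916, 21024, 21026, 21036, 21037, 21312, 22464,
  22466, 22467, 22477, 22489, 22500, 22610, 22620, 22752, 22753, 22764, 24193, 24194, 24336, 24337,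
  25920, 41472, 41473, 41474, 41484, 41496, 41508, 41616, 41617, 41760, 43201, 43212, 43344, 43356,
  44928, 45072, 46656, 62232, 62352, 62353, 64080, 82944, 82945, 82956]

def kA1 : List ℕ :=
  [0, 1, 3, 5, 13, 15, 16, 24, 25, 26, 37, 48, 60, 145,
  146, 159, 168, 180, 181, 192, 289, 290, 291, 301, 302, 313, 324, 432,
  433, 444, 576, 1729, 1731, 1752, 1753, 1776, 1873, 1884, 1885, 1886, 1896, 2016,
  2172, 3456, 3458, 3469, 3492, 3600, 3624, 3744, 3756, 3888, 5184, 5185, 5186, 5196,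
  5340, 20736, 20738, 20739, 20748, 20750, 20760, 20761, 20773, 20880, 20882, 20894, 21036, 21048,
  21180, 22464, 22465, 22466, 22478, 22489, 22500, 22608, 22609, 22610, 22620, 22752, 22764, 22896,
  24192, 24193, 24204, 24216, 24348, 25920, 25921, 25932, 41472, 41485, 41496, 41497, 41508, 41617,
  41618, 41629, 43212, 43488, 44928, 62208, 62209, 62220, 62232, 62352, 62353, 62364, 63936, 63937,
  82944, 82956, 84672]

def kA2 : List ℕ :=
  [0, 2, 3, 12, 13, 16, 24, 36, 37, 48, 144, 145, 148, 157,
  159, 168, 288, 290, 291, 300, 301, 302, 432, 1729, 1732, 1741, 1742, 1753,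
  1764, 1875, 1885, 2018, 2160, 3457, 3468, 3480, 3492, 3601, 3602, 3612, 3613, 3624,
  5196, 5197, 5472, 6912, 6913, 6924, 20737, 20738, 20748, 20750, 20751, 20761, 20881, 20882,
  20883, 21025, 21168, 22464, 22465, 22467, 22477, 22753, 22764, 24192, 24204, 24216, 24336, 24337,
  25920, 25921, 25932, 26064, 41472, 41473, 41474, 41496, 41497, 41508, 41618, 43200, 43201, 43212,
  43345, 43356, 43488, 44928, 44929, 62352, 62496, 63936, 65664, 82945, 83088]

def kA3 : List ℕ :=
  [0, 2, 3, 4, 13, 14, 15, 37, 145, 146, 147, 180, 181, 290,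
  300, 302, 312, 313, 434, 445, 576, 577, 588, 1741, 1742, 1753, 1764, 1765,
  1873, 1897, 2016, 2018, 2028, 2160, 2161, 3457, 3459, 3468, 3469, 3600, 3601, 3612,
  3888, 5184, 5208, 6913, 8640, 20738, 20739, 20749, 20750, 20760, 20772, 20880, 20882, 20892,
  20916, 21036, 21168, 21312, 22464, 22465, 22476, 22477, 22489, 22500, 22609, 22620, 22632, 22752,
  24193, 24194, 24216, 24348, 25920, 27648, 41472, 41473, 41474, 41485, 41496, 41497, 41508, 41616,
  41617, 41628, 41629, 41640, 41760, 41761, 41772, 41904, 43201, 43224, 43344, 43356, 44940, 45072,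
  62209, 62232, 62352, 62364, 62496, 63936, 63937, 63948, 82944, 83088, 84672]

def kA4 : List ℕ :=
  [0, 3, 4, 13, 14, 15, 16, 25, 48, 60, 144, 145, 146, 148,
  156, 158, 159, 168, 180, 181, 192, 289, 300, 301, 302, 324, 432, 433,
  576, 577, 1753, 1764, 1872, 1873, 1874, 1884, 1885, 1886, 1896, 2017, 2018, 2028,
  2161, 2304, 3456, 3458, 3459, 3481, 3492, 3601, 3602, 3612, 3744, 3756, 5185, 5186,
  5329, 5340, 6912, 6913, 8640, 20737, 20739, 20748, 20749, 20750, 20760, 20761, 20772, 20784,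
  20881, 20904, 20905, 20916, 21024, 21025, 21048, 21168, 21169, 22476, 22478, 22488, 22500, 22608,
  22620, 22632, 22752, 22753, 22764, 22896, 24193, 24194, 24204, 24336, 24480, 25921, 41472, 41497,
  41508, 41616, 41628, 41760, 41904, 43213, 43356, 43488, 62209, 62221, 63936, 82956, 83088, 103680]

def kA5 : List ℕ :=
  [1753, 1764, 20739, 41485, 41496, 43212, 62220, 63936]

def kA6 : List ℕ :=
  [15, 147, 3469, 5185, 5328, 24193, 24204, 24336, 41617, 41628]

def kA7 : List ℕ :=
  [2017, 6912, 21025, 24204, 24336, 41617]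

def kA8 : List ℕ :=
  [180, 1753, 1764, 1896, 20761, 20904, 41485, 41628, 43201, 43344, 62209, 82944]

def kA9 : List ℕ :=
  [15, 37, 147, 1742, 2017, 2028, 3469, 3480, 3612, 5196, 6912, 20750, 20761, 21036,
  22466, 24193, 24336]

def kA10 : List ℕ :=
  [2, 13, 24, 1729, 1872, 20736, 20748, 20880]

def kA11 : List ℕ :=
  [2, 13, 145, 156, 1728, 1729, 1872, 41472, 41473, 41616]

def kA12 : List ℕ :=
  [1, 12, 13, 144, 145, 1872, 3456, 3468, 20737, 22464, 24192, 41472, 41473, 62208]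

def kA13 : List ℕ :=
  [1, 12, 144, 145, 288, 1729, 3468, 5184, 20748, 20880]

def kA14 : List ℕ :=
  [1, 12, 13, 144, 288, 1740, 20737, 22464]

def LA : List (List ℕ × List ℕ) :=
  [(pA, [1728, 20736]),
   (kA0, pE),
   (kA1, rotL (pE)),
   (kA2, rotL (rotL (pE))),
   (kA3, rotL (rotL (rotL (pE)))),
   (kA4, rotL (rotL (rotL (rotL (pE))))),
   (kA5, pF),
   (kA6, rotL (pF)),
   (kA7, rotL (rotL (pF))),
   (kA8, rotL (rotL (rotL (pF)))),
   (kA9, rotL (rotL (rotL (rotL (pF))))),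
   (pQ, kA10),
   (rotL (pQ), kA11),
   (rotL (rotL (pQ)), kA12),
   (rotL (rotL (rotL (pQ))), kA13),
   (rotL (rotL (rotL (rotL (pQ)))), kA14)]

def kB0 : List ℕ :=
  [0, 3, 5, 13, 15, 25, 36, 37, 60, 144, 158, 169, 170, 180,
  192, 288, 291, 301, 302, 434, 445, 576, 577, 588, 1730, 1732, 1742, 1752,
  1764, 1873, 1874, 1875, 2016, 2018, 2172, 3458, 3469, 3492, 3600, 3602, 3612, 3624,
  3744, 3756, 3888, 5185, 5186, 20740, 20750, 20751, 20883, 20904, 21024, 21026, 21169, 21312,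
  22464, 22467, 22478, 22610, 22620, 22752, 22753, 24192, 41474, 41484, 41486, 41616, 41640, 41760,
  41904, 43200, 43201, 43212, 43344, 43345, 62220, 62221, 62232, 62352, 62353, 62364]

def kB1 : List ℕ :=
  [1, 2, 13, 14, 15, 25, 27, 48, 49, 60, 144, 145, 156, 158,
  288, 432, 434, 576, 577, 588, 720, 1728, 1729, 1730, 1731, 1732, 1740, 1752,
  1753, 1776, 1874, 1886, 1896, 2028, 2160, 3456, 3458, 3459, 3468, 3600, 3601, 3612,
  3744, 5328, 5329, 20737, 20738, 20740, 20749, 20750, 20761, 20772, 20773, 20784, 20880, 20892,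
  21025, 21026, 21037, 21168, 21169, 21180, 22464, 22465, 22489, 22608, 22609, 22632, 22752, 22753,
  22764, 22896, 24192, 24194, 24204, 24337, 25920, 25921, 26064, 41472, 41474, 41485, 41628, 41629,
  41760, 41772, 41904, 43224, 44929, 46656, 62208, 62496, 63936, 63948, 82945, 83088, 84672]

def kB2 : List ℕ :=
  [0, 3, 12, 13, 26, 48, 144, 147, 156, 159, 180, 181, 192, 288,
  289, 301, 312, 313, 324, 434, 1729, 1730, 1742, 1743, 1752, 1753, 1754, 1765,
  1776, 1873, 1874, 1884, 1886, 1896, 1897, 1908, 2028, 2029, 2160, 2161, 3459, 3468,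
  3469, 3480, 3481, 3492, 3602, 3613, 3744, 3888, 5184, 5185, 5186, 5197, 5208, 5328,
  6912, 6913, 20738, 20740, 20748, 20750, 20760, 20761, 20772, 20882, 21024, 21036, 21037, 21168,
  21169, 22464, 22465, 22466, 22476, 22477, 22488, 22609, 22610, 22752, 22753, 22896, 24194, 24204,
  24216, 25921, 25932, 41472, 41473, 41484, 41508, 41617, 41618, 41761, 41772, 41904, 43212, 43213,
  43224, 43344, 43356, 43488, 44928, 44929, 46656, 62221, 63936, 63937, 63948, 65664, 82945, 103680]

def kB3 : List ℕ :=
  [0, 1, 2, 3, 12, 13, 24, 26, 36, 48, 158, 159, 168, 180,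
  192, 288, 289, 300, 301, 302, 433, 444, 445, 720, 1730, 1740, 1742, 1752,
  1764, 1776, 1872, 1885, 1908, 2016, 2018, 2029, 3457, 3458, 3468, 3602, 3744, 5184,
  5185, 5197, 5340, 6912, 6924, 20736, 20738, 20749, 20750, 20760, 20761, 20880, 20881, 20883,
  20892, 20894, 21026, 21036, 21037, 21168, 21180, 22464, 22465, 22609, 22620, 22632, 22753, 22764,
  24193, 24194, 24216, 24336, 24348, 25921, 41472, 41485, 41496, 41497, 41616, 41617, 41628, 41629,
  41640, 41760, 41761, 41772, 41904, 43200, 43212, 43213, 43344, 44929, 46656, 62209, 62221, 62353,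
  62364, 62496, 63937, 63948, 65664, 82945, 83088]

def kB4 : List ℕ :=
  [1, 2, 4, 12, 15, 16, 25, 26, 37, 48, 49, 145, 147, 148,
  168, 169, 180, 181, 288, 289, 290, 301, 434, 576, 720, 1729, 1730, 1731,
  1740, 1741, 1742, 1743, 1752, 1764, 1765, 1776, 1872, 1875, 1885, 1897, 2017, 2018,
  2028, 2029, 2040, 2160, 3458, 3459, 3468, 3481, 3600, 3602, 3612, 5185, 5196, 5328,
  5329, 5340, 5472, 6924, 8640, 20737, 20739, 20748, 20749, 20750, 20751, 20773, 20880, 20883,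
  20916, 21026, 21036, 21168, 21312, 22466, 22478, 22489, 22500, 22609, 22610, 22620, 22896, 24194,
  24336, 24348, 25921, 25932, 26064, 41496, 41497, 41617, 41640, 43344, 43488, 62352, 62496]

def kB5 : List ℕ :=
  [301, 433, 444, 576, 1896, 2017, 2028, 2160, 21025, 22752, 41617, 43201, 43344]

def kB6 : List ℕ :=
  [1874, 41628, 43212]

def kB7 : List ℕ :=
  [15, 2017, 2028, 2160, 3612, 6912, 20739, 20750, 21025, 21036, 21168, 22752, 25920, 62209]

def kB8 : List ℕ :=
  [2017, 2028, 3469, 21036, 24204, 24336]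

def kB9 : List ℕ :=
  [15, 147, 169, 290, 2160, 20750, 20882, 21168, 22752]

def kB10 : List ℕ :=
  [0, 1, 14, 144, 145, 156, 288, 1728, 1740, 1872, 20736, 20737, 20738, 20748,
  20880]

def kB11 : List ℕ :=
  [1, 12, 145, 156, 20737, 20748]

def kB12 : List ℕ :=
  [0, 1728, 1740, 1872, 3456, 20748, 20880]

def kB13 : List ℕ :=
  [1, 145, 288, 1728, 20737, 20880]

def kB14 : List ℕ :=
  [1, 12, 13, 24, 144, 145, 288, 300, 432, 1728]

def LB : List (List ℕ × List ℕ) :=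
  [(pB, [144, 156, 288, 20736, 20748, 20880]),
   (kB0, pE),
   (kB1, rotL (pE)),
   (kB2, rotL (rotL (pE))),
   (kB3, rotL (rotL (rotL (pE)))),
   (kB4, rotL (rotL (rotL (rotL (pE))))),
   (kB5, pF),
   (kB6, rotL (pF)),
   (kB7, rotL (rotL (pF))),
   (kB8, rotL (rotL (rotL (pF)))),
   (kB9, rotL (rotL (rotL (rotL (pF))))),
   (pQ, kB10),
   (rotL (pQ), kB11),
   (rotL (rotL (pQ)), kB12),
   (rotL (rotL (rotL (pQ))), kB13),
   (rotL (rotL (rotL (rotL (pQ)))), kB14)]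

def kC0 : List ℕ :=
  [2, 5, 24, 25, 36, 37, 48, 49, 60, 144, 145, 146, 147, 148,
  157, 159, 168, 169, 192, 288, 300, 301, 432, 433, 434, 444, 576, 577,
  588, 1728, 1729, 1730, 1732, 1740, 1752, 1764, 1765, 1872, 1873, 1908, 2017, 2172,
  2304, 3457, 3459, 3468, 3469, 3480, 3492, 3602, 3612, 3613, 3745, 5184, 5185, 5186,
  5196, 5208, 5329, 5340, 6912, 6924, 8640, 20736, 20737, 20740, 20751, 20762, 20772, 20784,
  20880, 20882, 20883, 20892, 20893, 20905, 21024, 21026, 22465, 22466, 22476, 22608, 22610, 22621,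
  22752, 22896, 24194, 24204, 24205, 24336, 25921, 41472, 41473, 41485, 41508, 41617, 41640, 41761,
  41772, 41904, 43212, 43213, 43488, 45072, 46656, 62209, 62232, 62353, 62364, 63936, 63937, 63948]

def kC1 : List ℕ :=
  [0, 1, 4, 5, 13, 15, 16, 24, 38, 49, 60, 145, 147, 148,
  156, 159, 169, 181, 192, 288, 290, 291, 301, 302, 312, 432, 433, 434,
  1730, 1731, 1740, 1741, 1742, 1743, 1753, 1764, 1776, 1875, 1884, 1886, 1896, 2018,
  2028, 2029, 2161, 2304, 3458, 3469, 3470, 3481, 3492, 3600, 3612, 3624, 3744, 3756,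
  3888, 5184, 5185, 5196, 5197, 5328, 5329, 5340, 6913, 20737, 20738, 20740, 20748, 20749,
  20760, 20772, 20773, 20880, 20882, 20894, 20904, 20905, 21024, 21025, 21037, 21168, 21169, 22464,
  22465, 22466, 22476, 22477, 22478, 22489, 22500, 22620, 22632, 22753, 22764, 24192, 24193, 24205,
  24336, 24337, 24348, 25921, 26064, 27648, 41472, 41485, 41496, 41497, 41616, 41618, 41629, 41760,
  43224, 43344, 43345, 44928, 45072, 62208, 62209, 62220, 62221, 62352, 62353, 82944, 83088, 84672]

def kC2 : List ℕ :=
  [0, 2, 5, 12, 15, 24, 25, 36, 37, 145, 158, 168, 169, 290,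
  291, 302, 433, 434, 444, 445, 576, 1728, 1732, 1741, 1742, 1743, 1752, 1776,
  1872, 1873, 1884, 1886, 1897, 2016, 2017, 2018, 2028, 2029, 2172, 2304, 3457, 3469,
  3481, 3492, 3600, 3624, 3745, 5185, 5186, 5197, 5208, 5328, 5329, 6913, 20736, 20737,
  20739, 20749, 20751, 20773, 20880, 20881, 20882, 20883, 20892, 20893, 20904, 21024, 21026, 21036,
  21037, 21168, 21169, 21180, 21312, 22465, 22467, 22488, 22610, 22632, 22753, 22764, 22896, 24192,
  24193, 24204, 24336, 24337, 24348, 25921, 25932, 26064, 41474, 41496, 41497, 41616, 41628, 41629,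
  41760, 41761, 41904, 43200, 43201, 43212, 62208, 62209, 62220, 62232, 62352, 62353, 62496, 63948,
  64080, 82944, 84672, 103680]

def kC3 : List ℕ :=
  [3, 13, 14, 25, 26, 37, 144, 146, 148, 158, 170, 180, 181, 288,
  289, 290, 300, 301, 302, 444, 588, 720, 1729, 1731, 1741, 1753, 1754, 1765,
  1873, 1875, 1884, 1885, 1886, 1897, 2028, 2029, 2304, 3458, 3459, 3468, 3469, 3480,
  3600, 3601, 3602, 3613, 3744, 5184, 5185, 5186, 5196, 5197, 5329, 5340, 6913, 6924,
  7056, 8640, 20737, 20738, 20772, 20880, 20882, 20883, 20892, 20905, 20916, 21024, 21036, 21168,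
  21180, 22466, 22488, 22489, 22500, 22610, 22621, 22632, 24192, 24194, 24336, 24337, 41472, 41475,
  41485, 41616, 41629, 41761, 43200, 43224, 43488, 46656, 62208, 62209, 62210, 62232, 62352, 63937,
  63948, 82944, 82956, 83088]

def kC4 : List ℕ :=
  [0, 2, 3, 13, 15, 24, 37, 60, 144, 146, 147, 156, 157, 159,
  168, 180, 181, 289, 300, 302, 433, 434, 577, 588, 720, 1742, 1764, 1776,
  1872, 1875, 1884, 1885, 1896, 1908, 2018, 2029, 2040, 2160, 3456, 3458, 3459, 3468,
  3469, 3480, 3481, 3600, 3602, 5184, 5185, 5186, 5197, 5328, 6912, 6913, 20738, 20739,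
  20750, 20772, 20880, 20882, 20893, 20894, 20904, 20905, 20916, 21026, 21037, 21312, 22464, 22465,
  22467, 22476, 22488, 22489, 22609, 22610, 22620, 22753, 24192, 24193, 24336, 24337, 25920, 25932,
  26064, 41472, 41473, 41496, 41616, 41628, 41760, 41772, 43201, 43212, 43356, 44928, 62220, 62232,
  62352, 62496, 63936, 63948, 64080, 82944, 82956, 83088, 103680]

def kC5 : List ℕ :=
  [4, 37, 158, 576, 1742, 1753, 41617, 41628, 43201, 43212]

def kC6 : List ℕ :=
  [4, 37, 48, 169, 1742, 1753, 1885, 3458, 3469, 3480, 3601, 5328, 20761, 20772,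
  20904, 22488, 22620, 24193, 25920, 41628, 43212, 43344, 63936]

def kC7 : List ℕ :=
  [4, 158, 290, 301, 444, 1731, 1742, 1874, 2017, 2028, 20739, 21025, 21036, 21168,
  22466, 22752, 24193, 24204, 41485, 62220]

def kC8 : List ℕ :=
  [180, 1764, 1885, 2017, 3612, 20761, 20893, 20904, 22477, 22488, 22609, 22620, 22752, 41485,
  41496, 41628, 62352, 82944]

def kC9 : List ℕ :=
  [37, 147, 301, 1742, 1885, 1896, 2017, 3458, 5185, 5196, 20739, 20761, 20882, 20893,
  20904, 22477, 22609, 22620, 24204, 25920]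

def kC10 : List ℕ :=
  [1, 3, 12, 24, 145, 157, 288, 1728, 1730, 1740, 1741, 1872, 1873, 3457,
  3468, 20736, 20892, 22464, 22476, 22608]

def kC11 : List ℕ :=
  [1, 2, 24, 144, 145, 289, 1728, 2016, 20880, 22464]

def kC12 : List ℕ :=
  [12, 13, 25, 144, 1729, 1872, 3456, 3600, 5184, 20748, 20760, 22464, 41473, 62208]

def kC13 : List ℕ :=
  [12, 14, 145, 156, 300, 432, 1730, 1740, 3456, 3457, 5184, 20880, 22464, 41472]

def kC14 : List ℕ :=
  [1, 13, 36, 144, 156, 1728, 1872, 3456, 3457, 3600, 20748, 20760, 20880, 22464]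

def kC15 : List ℕ :=
  [145, 1872, 20737, 22464]

def LC : List (List ℕ × List ℕ) :=
  [(pC, [144, 156, 288, 20736, 20748, 20880]),
   (kC0, pE),
   (kC1, rotL (pE)),
   (kC2, rotL (rotL (pE))),
   (kC3, rotL (rotL (rotL (pE)))),
   (kC4, rotL (rotL (rotL (rotL (pE))))),
   (kC5, pF),
   (kC6, rotL (pF)),
   (kC7, rotL (rotL (pF))),
   (kC8, rotL (rotL (rotL (pF)))),
   (kC9, rotL (rotL (rotL (rotL (pF))))),
   (pQ, kC10),
   (rotL (pQ), kC11),
   (rotL (rotL (pQ)), kC12),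
   (rotL (rotL (rotL (pQ))), kC13),
   (rotL (rotL (rotL (rotL (pQ)))), kC14),
   (pA, kC15)]

def kHE : List ℕ :=
  [2, 3, 4, 5, 12, 13, 14, 16, 24, 26, 49, 60, 144, 156,
  157, 158, 159, 169, 170, 182, 192, 193, 204, 289, 292, 301, 302, 303,
  312, 313, 314, 325, 432, 433, 435, 445, 446, 456, 468, 577, 578, 588,
  589, 600, 732, 864, 1741, 1742, 1744, 1765, 1777, 1788, 1873, 1875, 1876, 1885,
  1886, 1887, 1897, 1898, 1909, 1920, 2019, 2029, 2052, 2161, 2162, 2172, 2184, 2304,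
  2316, 3457, 3460, 3468, 3470, 3480, 3603, 3614, 3900, 5184, 5185, 5187, 5196, 5197,
  5198, 5220, 5328, 5329, 5341, 5472, 6914, 6924, 6936, 7057, 7200, 8640, 8641, 8652,
  20736, 20737, 20748, 20750, 20774, 20880, 20881, 20882, 20884, 20894, 20905, 20928, 21024, 21037,
  21038, 21048, 21180, 21312, 21324, 21456, 22465, 22466, 22467, 22468, 22476, 22477, 22479, 22489,
  22500, 22608, 22611, 22620, 22621, 22633, 22752, 22754, 22765, 22776, 22908, 23040, 24193, 24194,
  24195, 24204, 24205, 24206, 24360, 24492, 25922, 25933, 26064, 26076, 26208, 27649, 27792, 41472,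
  41476, 41484, 41485, 41486, 41496, 41509, 41520, 41629, 41630, 41641, 41784, 41916, 42048, 43201,
  43213, 43224, 43225, 43236, 43345, 43346, 43357, 43489, 44941, 45216, 46668, 46800, 62208, 62221,
  62244, 62352, 62353, 62364, 62497, 63937, 63948, 63949, 65664, 65808, 82944, 82956, 82957, 83089,
  83100, 84672, 84673, 103680, 103681, 103692, 103824, 105408, 124416]

def kHA : List ℕ :=
  [22464, 22608, 41473, 41616, 41617, 41629, 43200, 43212, 43224, 43488, 44929, 45072, 62220, 62221,
  62232, 62353, 62364, 62496]

def kHB : List ℕ :=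
  [22464, 22476, 41472, 41628, 41629, 41760, 41761, 43213, 43344, 43488, 62209, 62353, 62364, 63937,
  63948, 65664, 82956, 84672]

def kHC : List ℕ :=
  [20880, 41485, 41616, 41628, 43224, 43488, 45072, 82944, 82945, 83088]

def LH : List (List ℕ × List ℕ) :=
  [(pH, pH),
   (pU, [0]),
   (kHE, pE),
   (rotL (kHE), rotL (pE)),
   (rotL (rotL (kHE)), rotL (rotL (pE))),
   (rotL (rotL (rotL (kHE))), rotL (rotL (rotL (pE)))),
   (rotL (rotL (rotL (rotL (kHE)))), rotL (rotL (rotL (rotL (pE))))),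
   (pA, orb kHA),
   (orb kHB, pB),
   (orb kHC, pC)]

def kUE : List ℕ :=
  [0, 3, 4, 5, 7, 12, 17, 24, 25, 27, 36, 48, 49, 84,
  146, 150, 156, 157, 158, 159, 161, 168, 169, 183, 192, 193, 205, 290,
  291, 300, 303, 337, 432, 435, 445, 446, 456, 576, 577, 589, 600, 732,
  733, 864, 865, 876, 1728, 1731, 1733, 1734, 1741, 1744, 1752, 1753, 1754, 1755,
  1765, 1767, 1777, 1800, 1873, 1875, 1885, 1886, 1888, 1896, 1897, 1908, 1910, 1921,
  2016, 2017, 2020, 2028, 2029, 2030, 2053, 2160, 2163, 2172, 2184, 2196, 2304, 2328,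
  2448, 2460, 3457, 3458, 3459, 3468, 3471, 3481, 3483, 3492, 3493, 3504, 3505, 3516,
  3600, 3601, 3602, 3613, 3614, 3624, 3625, 3636, 3637, 3648, 3745, 3888, 3890, 3901,
  4176, 5185, 5186, 5188, 5198, 5208, 5209, 5221, 5232, 5331, 5340, 5341, 5364, 5473,
  5617, 5628, 6913, 6925, 6936, 6937, 6948, 7056, 7058, 7069, 7200, 7212, 8640, 8652,
  8664, 20736, 20737, 20739, 20740, 20741, 20742, 20748, 20749, 20752, 20772, 20773, 20775, 20785,
  20880, 20882, 20884, 20885, 20893, 20895, 20916, 20918, 20928, 20940, 21024, 21026, 21027, 21037,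
  21049, 21060, 21072, 21171, 21180, 21181, 21313, 21325, 21456, 21468, 22466, 22479, 22488, 22513,
  22612, 22621, 22622, 22633, 22656, 22753, 22754, 22766, 22776, 22896, 22909, 23040, 23052, 23184,
  24195, 24196, 24204, 24216, 24217, 24218, 24338, 24348, 24361, 24480, 24624, 24625, 25920, 25921,
  25933, 25934, 25945, 26064, 26065, 26066, 26076, 26077, 26088, 26208, 26209, 26352, 27649, 27661,
  27792, 29377, 29388, 41473, 41476, 41484, 41485, 41508, 41509, 41521, 41617, 41619, 41629, 41630,
  41641, 41653, 41760, 41773, 41774, 41784, 41905, 41916, 41917, 41928, 43212, 43213, 43214, 43224,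
  43225, 43236, 43237, 43344, 43356, 43368, 43490, 43633, 43644, 43776, 44929, 44941, 44952, 44964,
  45074, 45084, 45085, 45096, 45228, 46669, 46801, 46812, 48384, 48385, 48528, 62208, 62209, 62221,
  62233, 62244, 62352, 62353, 62365, 62376, 62377, 62388, 62496, 62497, 62508, 62520, 62640, 62641,
  62652, 63937, 63938, 63948, 63972, 64080, 64092, 64368, 65664, 65676, 65952, 82945, 82947, 82958,
  82969, 82980, 83088, 83089, 83101, 83112, 83233, 84674, 84816, 84817, 84828, 84960, 86401, 86544,
  103680, 103692, 103704, 105409, 105552, 124416, 124428, 124560]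

def kUA : List ℕ :=
  [20736, 20880, 22464, 22608, 41472, 41484, 41485, 41760, 43200, 43201, 43213, 43357, 43489, 62208,
  62209, 62221, 62233, 62352, 62365, 62497, 63936, 63937, 82956, 82957, 84672, 84673, 84684, 84816]

def kUB : List ℕ :=
  [0, 22464, 22608, 41617, 43213, 43357, 62209, 62220, 63960, 64081, 83232, 84672, 84684, 84816,
  103824]

def kUC : List ℕ :=
  [20736, 20880, 22464, 22476, 22620, 41473, 41616, 41617, 43368, 62208, 62233, 62364, 62365, 62376,
  64081, 64224, 82956, 82957, 82968, 83088, 83089, 83100, 83232, 84684, 103824]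

def LU : List (List ℕ × List ℕ) :=
  [(pU, pH),
   (pH, [0]),
   ([0], [0]),
   (kUE, pE),
   (rotL (kUE), rotL (pE)),
   (rotL (rotL (kUE)), rotL (rotL (pE))),
   (rotL (rotL (rotL (kUE))), rotL (rotL (rotL (pE)))),
   (rotL (rotL (rotL (rotL (kUE)))), rotL (rotL (rotL (rotL (pE))))),
   (pA, orb kUA),
   (orb kUB, pB),
   (orb kUC, pC)]

theorem cF : check LF = true := by decide +kernel
theorem cQ : check LQ = true := by decide +kernel
theorem cA : check LA = true := by decide +kernel
theorem cB : check LB = true := by decide +kernel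
theorem cC : check LC = true := by decide +kernel
theorem cH : check LH = true := by decide +kernel
theorem cU : check LU = true := by decide +kernel


section fin
set_option linter.unusedSectionVars false
variable {K : Type*} [Field K] [CharP K 2]

def G1 (a b c d e : K) : Prop :=
  ev a b c d e pE = 0 ∧ a * (a + 1) ≠ 0 ∧ a + b ≠ 0 ∧ (a + c) * (c + d + 1) ≠ 0

def Good (a b c d e : K) : Prop :=
  G1 a b c d e ∧ G1 b c d e a ∧ G1 c d e a b ∧ G1 d e a b c ∧ G1 e a b c d

theorem Good.rot {a b c d e : K} (h : Good a b c d e) : Good b c d e a :=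
  ⟨h.2.1, h.2.2.1, h.2.2.2.1, h.2.2.2.2, h.1⟩

theorem rots {l : List ℕ} (H : ∀ a b c d e : K, Good a b c d e → ev a b c d e l = 0)
    (a b c d e : K) (h : Good a b c d e) :
    ev a b c d e l = 0 ∧ ev a b c d e (rotL l) = 0 ∧ ev a b c d e (rotL (rotL l)) = 0 ∧
    ev a b c d e (rotL (rotL (rotL l))) = 0 ∧ ev a b c d e (rotL (rotL (rotL (rotL l)))) = 0 := by
  simp only [ev_rot]
  exact ⟨H _ _ _ _ _ h, H _ _ _ _ _ h.rot, H _ _ _ _ _ h.rot.rot, H _ _ _ _ _ h.rot.rot.rot,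
    H _ _ _ _ _ h.rot.rot.rot.rot⟩

theorem zE (a b c d e : K) (h : Good a b c d e) : ev a b c d e pE = 0 := h.1.1

theorem zF (a b c d e : K) (h : Good a b c d e) : ev a b c d e pF = 0 := by
  obtain ⟨e0, e1, e2, e3, e4⟩ := rots zE a b c d e h
  have h1 : ev a b c d e [0] = 1 := by simp [ev, val]
  have := sound LF cF a b c d e
  simpa only [LF, List.map_cons, List.map_nil, List.sum_cons, List.sum_nil, mul_zero, add_zero,
    mul_one, h1, e0, e1] using this

theorem zQ (a b c d e : K) (h : Good a b c d e) : ev a b c d e pQ = 0 := by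
  obtain ⟨e0, e1, e2, e3, e4⟩ := rots zE a b c d e h
  obtain ⟨f0, f1, f2, f3, f4⟩ := rots zF a b c d e h
  have hw : ev a b c d e [20736, 41472] = a * (a + 1) := by
    simp [ev, val]; try ring
  have := sound LQ cQ a b c d e
  simp only [LQ, List.map_cons, List.map_nil, List.sum_cons, List.sum_nil, mul_zero, zero_mul, add_zero, hw,
    e0, e1, e2, e3, e4, f0, f1, f2, f3, f4] at this
  exact (mul_eq_zero.mp this).resolve_right h.1.2.1

theorem zA (a b c d e : K) (h : Good a b c d e) : ev a b c d e pA = 0 := by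
  obtain ⟨e0, e1, e2, e3, e4⟩ := rots zE a b c d e h
  obtain ⟨f0, f1, f2, f3, f4⟩ := rots zF a b c d e h
  obtain ⟨q0, q1, q2, q3, q4⟩ := rots zQ a b c d e h
  have hw : ev a b c d e [1728, 20736] = a + b := by
    simp [ev, val]; try ring
  have := sound LA cA a b c d e
  simp only [LA, List.map_cons, List.map_nil, List.sum_cons, List.sum_nil, mul_zero, zero_mul, add_zero, hw,
    e0, e1, e2, e3, e4, f0, f1, f2, f3, f4, q0, q1, q2, q3, q4] at this
  exact (mul_eq_zero.mp this).resolve_right h.1.2.2.1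

theorem zB (a b c d e : K) (h : Good a b c d e) : ev a b c d e pB = 0 := by
  obtain ⟨e0, e1, e2, e3, e4⟩ := rots zE a b c d e h
  obtain ⟨f0, f1, f2, f3, f4⟩ := rots zF a b c d e h
  obtain ⟨q0, q1, q2, q3, q4⟩ := rots zQ a b c d e h
  have a0 := zA a b c d e h
  have hw : ev a b c d e [144, 156, 288, 20736, 20748, 20880] = (a + c) * (c + d + 1) := by
    simp [ev, val]; try ring
  have := sound LB cB a b c d e
  simp only [LB, List.map_cons, List.map_nil, List.sum_cons, List.sum_nil, mul_zero, zero_mul, add_zero, hw,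
    e0, e1, e2, e3, e4, f0, f1, f2, f3, f4, q0, q1, q2, q3, q4, a0] at this
  exact (mul_eq_zero.mp this).resolve_right h.1.2.2.2

theorem zC (a b c d e : K) (h : Good a b c d e) : ev a b c d e pC = 0 := by
  obtain ⟨e0, e1, e2, e3, e4⟩ := rots zE a b c d e h
  obtain ⟨f0, f1, f2, f3, f4⟩ := rots zF a b c d e h
  obtain ⟨q0, q1, q2, q3, q4⟩ := rots zQ a b c d e h
  have a0 := zA a b c d e h
  have hw : ev a b c d e [144, 156, 288, 20736, 20748, 20880] = (a + c) * (c + d + 1) := by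
    simp [ev, val]; try ring
  have := sound LC cC a b c d e
  simp only [LC, List.map_cons, List.map_nil, List.sum_cons, List.sum_nil, mul_zero, zero_mul, add_zero, hw,
    e0, e1, e2, e3, e4, f0, f1, f2, f3, f4, q0, q1, q2, q3, q4, a0] at this
  exact (mul_eq_zero.mp this).resolve_right h.1.2.2.2

theorem zH (a b c d e : K) (h : Good a b c d e) :
    ev a b c d e pH * ev a b c d e pH + ev a b c d e pU = 0 := by
  obtain ⟨e0, e1, e2, e3, e4⟩ := rots zE a b c d e h
  have a0 := zA a b c d e h
  have b0 := zB a b c d e h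
  have c0 := zC a b c d e h
  have h1 : ev a b c d e [0] = 1 := by simp [ev, val]
  have := sound LH cH a b c d e
  simpa only [LH, List.map_cons, List.map_nil, List.sum_cons, List.sum_nil, mul_zero, zero_mul, add_zero,
    mul_one, h1, e0, e1, e2, e3, e4, a0, b0, c0] using this

theorem zU (a b c d e : K) (h : Good a b c d e) :
    ev a b c d e pU * ev a b c d e pH + (ev a b c d e pH + 1) = 0 := by
  obtain ⟨e0, e1, e2, e3, e4⟩ := rots zE a b c d e h
  have a0 := zA a b c d e h
  have b0 := zB a b c d e h
  have c0 := zC a b c d e h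
  have h1 : ev a b c d e [0] = 1 := by simp [ev, val]
  have := sound LU cU a b c d e
  simpa only [LU, List.map_cons, List.map_nil, List.sum_cons, List.sum_nil, mul_zero, zero_mul, add_zero,
    mul_one, h1, e0, e1, e2, e3, e4, a0, b0, c0] using this

theorem hcube (a b c d e : K) (h : Good a b c d e) : ∃ t : K, t ^ 3 = t + 1 := by
  refine ⟨ev a b c d e pH, ?_⟩
  have h1 := zH a b c d e h
  have h2 := zU a b c d e h
  generalize ev a b c d e pH = t at *
  generalize ev a b c d e pU = u at *
  have hu : u = - (t * t) := by linear_combination h1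
  subst hu
  have h3 : (2 : K) = 0 := CharTwo.two_eq_zero
  linear_combination -h2 + (t + 1) * (1 - 1) * h3

theorem evE (a b c d e : K) : ev a b c d e pE = c ^ 2 * (a + b + 1) + a * b * (a * b + a + b) := by
  simp [ev, val, pE]; ring

theorem step {a b c d e : K} (h0 : a ≠ 0) (h1 : a + 1 ≠ 0)
    (he : ev a b c d e pE = 0) (hab : a + b ≠ 0) (hac : a + c ≠ 0) (hcd : c + d + 1 ≠ 0) :
    G1 a b c d e :=
  ⟨he, mul_ne_zero h0 h1, hab, mul_ne_zero hac hcd⟩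

theorem main (φ : K →+* K) (x : K) (h5 : φ (φ (φ (φ (φ x)))) = x) (h0 : x ≠ 0) (h1 : x ≠ 1)
    (hE : (φ (φ x)) ^ 2 * (x + φ x + 1) + x * φ x * (x * φ x + x + φ x) = 0) :
    ∃ t : K, t ^ 3 = t + 1 := by
  have two : (2 : K) = 0 := CharTwo.two_eq_zero
  have eqn : ∀ y z : K, y + z = 0 → z = y := by
    intro y z h; linear_combination h - y * two
  have hfix : φ x ≠ x := by
    intro h
    simp only [h] at hE
    have : (x * (x - 1)) ^ 2 = 0 := by linear_combination hE - 3 * x ^ 3 * two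
    have := pow_eq_zero_iff (two_ne_zero) |>.mp this
    rcases mul_eq_zero.mp this with h | h
    · exact h0 h
    · exact h1 (by linear_combination h)
  have hac' : φ (φ x) ≠ x := by
    intro h
    rw [h, h] at h5
    exact hfix h5
  have hinj := φ.injective
  have n1 : x + 1 ≠ 0 := fun h => h1 (eqn _ _ h).symm
  have nab : x + φ x ≠ 0 := fun h => hfix (eqn _ _ h)
  have nac : x + φ (φ x) ≠ 0 := fun h => hac' (eqn _ _ h)
  have ns : x + φ x + 1 ≠ 0 := by
    intro h
    have h' : φ x = x + 1 := by linear_combination h - (x + 1) * two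
    apply hac'
    rw [h', map_add, h', map_one]
    linear_combination two
  have up : ∀ y : K, y ≠ 0 → φ y ≠ 0 := fun y hy => (map_ne_zero φ).mpr hy
  have key : ∀ y : K, φ (φ (φ (φ (φ y)))) = y → y ≠ 0 → y + 1 ≠ 0 → y + φ y ≠ 0 →
      y + φ (φ y) ≠ 0 → y + φ y + 1 ≠ 0 →
      (φ (φ y)) ^ 2 * (y + φ y + 1) + y * φ y * (y * φ y + y + φ y) = 0 →
      G1 y (φ y) (φ (φ y)) (φ (φ (φ y))) (φ (φ (φ (φ y)))) ∧
      (φ (φ (φ (φ (φ (φ y))))) = φ y ∧ φ y ≠ 0 ∧ φ y + 1 ≠ 0 ∧ φ y + φ (φ y) ≠ 0 ∧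
      φ y + φ (φ (φ y)) ≠ 0 ∧ φ y + φ (φ y) + 1 ≠ 0 ∧
      (φ (φ (φ y))) ^ 2 * (φ y + φ (φ y) + 1) +
        φ y * φ (φ y) * (φ y * φ (φ y) + φ y + φ (φ y)) = 0) := by
    intro y y5 y0 y1 yab yac ys yE
    refine ⟨step y0 y1 ((evE _ _ _ _ _).trans yE) yab yac ?_, ?_, up _ y0, ?_, ?_, ?_, ?_, ?_⟩
    · simpa using up _ (up _ ys)
    · rw [y5]
    · simpa using up _ y1
    · simpa using up _ yab
    · simpa using up _ yac
    · simpa using up _ ys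
    · simpa using congrArg φ yE
  obtain ⟨g0, p5, p0, p1, pab, pac, ps, pe⟩ := key x h5 h0 n1 nab nac ns hE
  obtain ⟨g1, q5, q0, q1, qab, qac, qs, qe⟩ := key _ p5 p0 p1 pab pac ps pe
  obtain ⟨g2, r5, r0, r1, rab, rac, rs, re⟩ := key _ q5 q0 q1 qab qac qs qe
  obtain ⟨g3, s5, s0, s1, sab, sac, ss, se⟩ := key _ r5 r0 r1 rab rac rs re
  obtain ⟨g4, -⟩ := key _ s5 s0 s1 sab sac ss se
  simp only [h5] at g0 g1 g2 g3 g4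
  exact hcube _ _ _ _ _ ⟨g0, g1, g2, g3, g4⟩

end fin

end ZApn

theorem zero_apn_13 (m : ℕ) (hm : 0 < m) (hm3 : m % 3 ≠ 0)
    (x : GaloisField 2 (5*m)) (hx0 : x ≠ 0) (hx1 : x ≠ 1) :
    (x + 1) ^ (2^(2*m+1)-2^m-1) + x ^ (2^(2*m+1)-2^m-1) + 1 ≠ 0 := by
  intro hD
  have two : (2 : GaloisField 2 (5*m)) = 0 := CharTwo.two_eq_zero
  have hcard : ∀ y : GaloisField 2 (5*m), y ^ (2 ^ (5*m)) = y := by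
    intro y
    have := Fintype.ofFinite (GaloisField 2 (5*m))
    have h := FiniteField.pow_card y
    rw [← Nat.card_eq_fintype_card, GaloisField.card 2 (5*m) (by omega)] at h
    exact h
  have hexp : (2^(2*m+1)-2^m-1) + 2^m + 1 = 2^m * 2^m * 2 := by
    have e1 : 2^(2*m+1) = 2^m * 2^m * 2 := by rw [pow_succ, two_mul, pow_add]
    have e2 : 2 ≤ 2^m := by
      calc 2 = 2^1 := rfl
        _ ≤ 2^m := Nat.pow_le_pow_right (by norm_num) hm
    have e3 : 2^m + 1 ≤ 2^m * 2^m * 2 := by nlinarith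
    rw [e1]; omega
  generalize 2^(2*m+1)-2^m-1 = D at *
  let φ := iterateFrobenius (GaloisField 2 (5*m)) 2 m
  have hφ : ∀ y, φ y = y ^ (2^m) := fun y => iterateFrobenius_def 2 m y
  have hpow : ∀ y : GaloisField 2 (5*m), y ^ D * φ y * y = (φ (φ y)) ^ 2 := by
    intro y
    rw [hφ, hφ, ← pow_mul, ← pow_mul, ← mul_assoc, ← hexp, pow_add, pow_add, pow_one]
  have h5 : φ (φ (φ (φ (φ x)))) = x := by
    simp only [hφ, ← pow_mul]
    rw [← pow_add, ← pow_add, ← pow_add, ← pow_add]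
    have : m + m + m + m + m = 5 * m := by ring
    rw [this]
    exact hcard x
  have hy := hpow x
  have hz := hpow (x + 1)
  rw [map_add, map_add, map_one, map_one] at hz
  have hE : (φ (φ x)) ^ 2 * (x + φ x + 1) + x * φ x * (x * φ x + x + φ x) = 0 := by
    generalize φ (φ x) = c at *
    generalize φ x = b at *
    generalize (x + 1) ^ D = z at *
    generalize x ^ D = y at *
    have hz' : z = y + 1 := by linear_combination hD - (y + 1) * two
    subst hz'
    linear_combination x * b * hz - (b + 1) * (x + 1) * hy + c * x * b * two
  obtain ⟨t, ht⟩ := ZApn.main φ x h5 hx0 hx1 hE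
  have t8 : t ^ 8 = t := by
    linear_combination t ^ 2 * (t ^ 3 + t + 1) * ht + t * ht + (t ^ 3 + t ^ 2) * two
  have hit : ∀ k : ℕ, t ^ (2 ^ (3 * k)) = t := by
    intro k
    induction k with
    | zero => simp
    | succ k ih =>
      rw [Nat.mul_succ, pow_add, pow_mul, ih]; exact t8
  have hc := hcard t
  have hsplit : 5 * m % 3 = 1 ∨ 5 * m % 3 = 2 := by omega
  have hdm : 5 * m = 3 * (5 * m / 3) + 5 * m % 3 := by omega
  have hc' : t ^ (2 ^ (5 * m % 3)) = t := by
    have e : 2 ^ (5 * m) = 2 ^ (3 * (5 * m / 3)) * 2 ^ (5 * m % 3) := by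
      rw [← pow_add, ← hdm]
    rw [e, pow_mul, hit] at hc
    exact hc
  rcases hsplit with h | h
  · rw [h] at hc'
    have h10 : (1 : GaloisField 2 (5*m)) = 0 := by
      linear_combination -ht + t * hc' + hc'
    exact one_ne_zero h10
  · rw [h] at hc'
    have h20 : t ^ 2 = 0 := by linear_combination hc' - t * ht
    have h0 : t = 0 := by simpa using h20
    rw [h0] at ht
    simp at ht
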